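/- arXiv:2409.15534 — 2 statements merged into one kernel-verified Lean document; each statement's English description precedes it below -/
import Mathlib

section
/- Let H be a finite-dimensional complex inner product space carrying an anti-unitary anti-involution τ, i.e. a bijective conjugate-linear map with ⟪τx, τy⟫ = ⟪y, x⟫ for all x, y ∈ H and τ ∘ τ = −id. Then the complex dimension of H is even. -/
/-- **Kramers' degeneracy, part (ii).**
Let `H` be a finite-dimensional complex inner product space carrying an
anti-unitary anti-involution `τ` (a bijective conjugate-linear map with
`⟪τ x, τ y⟫ = ⟪y, x⟫` for all `x, y` and `τ ∘ τ = -id`).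
Then the complex dimension of `H` is even. -/
theorem finrank_even_of_antiInvolution
    {H : Type*} [NormedAddCommGroup H] [InnerProductSpace ℂ H]
    [FiniteDimensional ℂ H]
    (τ : H →ₗ⋆[ℂ] H)
    (hbij : Function.Bijective τ)
    (hanti : ∀ x y : H, (inner ℂ (τ x) (τ y) : ℂ) = inner ℂ y x)
    (hinv : ∀ x : H, τ (τ x) = -x) :
    Even (Module.finrank ℂ H) := by
  classical
  let b := Module.finBasis ℂ H
  let A : Matrix (Fin (Module.finrank ℂ H)) (Fin (Module.finrank ℂ H)) ℂ :=
    Matrix.of fun i j => b.repr (τ (b j)) i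
  have hA : A * A.map (starRingEnd ℂ) = -1 := by
    ext i j
    have h1 : τ (τ (b j)) = ∑ k, (starRingEnd ℂ) (A k j) • τ (b k) := by
      conv_lhs => rw [← b.sum_repr (τ (b j))]
      rw [map_sum]
      exact Finset.sum_congr rfl fun k _ => τ.map_smulₛₗ _ _
    have h2 := congrArg (fun v => b.repr v i) h1
    simp only [hinv, map_neg, map_sum, map_smul, Finsupp.coe_neg, Pi.neg_apply,
      Finsupp.coe_finset_sum, Finset.sum_apply, Finsupp.coe_smul, Pi.smul_apply,
      smul_eq_mul, Module.Basis.repr_self] at h2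
    rw [Matrix.mul_apply, Matrix.neg_apply, Matrix.one_apply]
    rw [Finsupp.single_apply] at h2
    simp only [eq_comm (a := i) (b := j)]
    rw [h2]
    exact Finset.sum_congr rfl fun k _ => mul_comm _ _
  have hdet := congrArg Matrix.det hA
  have hmap : (A.map (starRingEnd ℂ)).det = (starRingEnd ℂ) A.det :=
    ((starRingEnd ℂ).map_det A).symm
  rw [Matrix.det_mul, hmap, Complex.mul_conj, Matrix.det_neg, Matrix.det_one, mul_one,
    Fintype.card_fin] at hdet
  by_contra hn
  rw [Nat.not_even_iff_odd] at hn
  rw [hn.neg_one_pow] at hdet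
  have h3 : Complex.normSq A.det = -1 := by exact_mod_cast hdet
  linarith [Complex.normSq_nonneg A.det]
end

section
/- Let H be a finite-dimensional complex inner product space carrying an anti-unitary anti-involution τ (a bijective conjugate-linear map with ⟪τx, τy⟫ = ⟪y, x⟫ for all x, y and τ ∘ τ = −id). Then there exists a complex linear subspace L of H such that H is the internal direct sum of L and τ(L), i.e. L ∩ τ(L) = {0} and L + τ(L) = H. -/
/-- **Kramers' degeneracy, part (iii).**
Let `H` be a finite-dimensional complex inner product space carrying an
anti-unitary anti-involution `τ` (a bijective conjugate-linear map with
`⟪τ x, τ y⟫ = ⟪y, x⟫` for all `x, y` and `τ ∘ τ = -id`).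
Then there is a complex subspace `L ⊆ H` such that `H` is the internal
direct sum of `L` and `τ(L)`: their intersection is `{0}` and every
element of `H` is a sum of an element of `L` and an element of `τ(L)`. -/
theorem exists_lagrangian_complement_of_antiInvolution
    {H : Type*} [NormedAddCommGroup H] [InnerProductSpace ℂ H]
    [FiniteDimensional ℂ H]
    (τ : H →ₗ⋆[ℂ] H)
    (hbij : Function.Bijective τ)
    (hanti : ∀ x y : H, (inner ℂ (τ x) (τ y) : ℂ) = inner ℂ y x)
    (hinv : ∀ x : H, τ (τ x) = -x) :
    ∃ L : Submodule ℂ H,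
      ((L : Set H) ∩ (τ '' (L : Set H)) = {0}) ∧
      (∀ x : H, ∃ a ∈ L, ∃ b ∈ τ '' (L : Set H), x = a + b) := by
  have hskew : ∀ x y : H, (inner ℂ x (τ y) : ℂ) = - inner ℂ y (τ x) := by
    intro x y
    have h := hanti x (τ y)
    rw [hinv, inner_neg_right] at h
    have h2 : (inner ℂ (τ y) x : ℂ) = - inner ℂ (τ x) y := h.symm
    rw [← inner_conj_symm x (τ y), h2, map_neg, inner_conj_symm]
  have hself : ∀ x : H, (inner ℂ x (τ x) : ℂ) = 0 := fun x => self_eq_neg.mp (hskew x x)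
  let S : Set (Submodule ℂ H) := {L | ∀ x ∈ L, ∀ y ∈ L, (inner ℂ x (τ y) : ℂ) = 0}
  have hS : S.Nonempty := by
    refine ⟨⊥, ?_⟩
    intro x hx y _
    rw [(Submodule.mem_bot ℂ).mp hx, inner_zero_left]
  obtain ⟨L, hL, hmax⟩ :=
    WellFounded.has_min (wellFounded_gt : WellFounded ((· > ·) : Submodule ℂ H → _ → Prop)) S hS
  have hL' : ∀ x ∈ L, ∀ y ∈ L, (inner ℂ x (τ y) : ℂ) = 0 := hL
  refine ⟨L, ?_, ?_⟩
  · ext x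
    constructor
    · rintro ⟨hx, y, hy, rfl⟩
      exact inner_self_eq_zero.mp (hL' _ hx y hy)
    · rintro rfl
      exact ⟨L.zero_mem, 0, L.zero_mem, map_zero τ⟩
  · have htop : L ⊔ L.map τ = ⊤ := by
      rw [← Submodule.orthogonal_eq_bot_iff, Submodule.eq_bot_iff]
      intro v hv
      have h1 : ∀ x ∈ L, (inner ℂ x v : ℂ) = 0 := fun x hx =>
        hv x (Submodule.mem_sup_left hx)
      have h2 : ∀ x ∈ L, (inner ℂ v (τ x) : ℂ) = 0 := fun x hx =>
        inner_eq_zero_symm.mp (hv _ (Submodule.mem_sup_right (Submodule.mem_map_of_mem hx)))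
      have h3 : ∀ x ∈ L, (inner ℂ x (τ v) : ℂ) = 0 := fun x hx => by
        rw [hskew, h2 x hx, neg_zero]
      have hmem : L ⊔ Submodule.span ℂ {v} ∈ S := by
        intro x hx y hy
        obtain ⟨a, ha, b, hb, rfl⟩ := Submodule.mem_sup.mp hx
        obtain ⟨c, hc, d, hd, rfl⟩ := Submodule.mem_sup.mp hy
        obtain ⟨s, rfl⟩ := Submodule.mem_span_singleton.mp hb
        obtain ⟨t, rfl⟩ := Submodule.mem_span_singleton.mp hd
        simp [inner_add_left, inner_add_right, inner_smul_left, inner_smul_right,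
          hL' a ha c hc, h2 c hc, h3 a ha, hself v]
      have hvL : v ∈ L := by
        by_contra hvn
        refine hmax _ hmem (lt_of_le_of_ne le_sup_left ?_)
        intro he
        apply hvn
        rw [he]
        exact Submodule.mem_sup_right (Submodule.mem_span_singleton_self v)
      exact inner_self_eq_zero.mp (h1 v hvL)
    intro x
    have hx : x ∈ L ⊔ L.map τ := by rw [htop]; trivial
    obtain ⟨a, ha, b, hb, rfl⟩ := Submodule.mem_sup.mp hx
    obtain ⟨c, hc, rfl⟩ := Submodule.mem_map.mp hb
    exact ⟨a, ha, τ c, ⟨c, hc, rfl⟩, rfl⟩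
end
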